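/- Fix m ∈ ℕ, r > 0 and constants e, A, K > 0. There exists a constant C, depending only on m, r, e, A, K, with the following property. Let ε ∈ (0,1) and λ ∈ [0,K]. Let a : cl(B(r,0)) → (symmetric m×m matrices) and c, δ : cl(B(r,0)) → ℝ be smooth, with Σ a_{ij}(x)ξ_iξ_j ≥ e|ξ|² for all x, ξ, with all partial derivatives of the a_{ij} and of c up to order m+2 bounded in absolute value by A, with sup|δ| + sup|c| ≤ Kε, and such that ∫(Σ a_{ij} ∂_iφ ∂_jφ + c φ²) dx ≥ 3K ∫ φ² dx for every φ ∈ C_c^∞(B(r,0)). If f is twice continuously differentiable on a neighbourhood of cl(B(r,0)) and satisfies −Σ_{i,j} ∂_i(a_{ij} ∂_j f) + c f − λ f = δ pointwise on B(r,0), then |f(0)| ≤ C ( ( ∫_{B(r,0)} (f² + |∇f|²) dx )^{1/2} + ε ). -/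

import Mathlib

open Set MeasureTheory

/-- The `i`-th partial derivative of `f : ℝᵐ → ℝ`. -/
noncomputable def pd {m : ℕ} (i : Fin m) (f : EuclideanSpace ℝ (Fin m) → ℝ) :
    EuclideanSpace ℝ (Fin m) → ℝ :=
  fun x => fderiv ℝ f x (EuclideanSpace.single i 1)

section PartialDerivatives

variable {m : ℕ} {i : Fin m} {f g : EuclideanSpace ℝ (Fin m) → ℝ} {x : EuclideanSpace ℝ (Fin m)}

lemma HasFDerivAt.pd_eq {f' : EuclideanSpace ℝ (Fin m) →L[ℝ] ℝ} (h : HasFDerivAt f f' x) :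
    pd i f x = f' (EuclideanSpace.single i 1) := by
  rw [pd, h.fderiv]

lemma pd_mul (hf : DifferentiableAt ℝ f x) (hg : DifferentiableAt ℝ g x) :
    pd i (fun y => f y * g y) x = pd i f x * g x + f x * pd i g x := by
  refine (HasFDerivAt.pd_eq (f := fun y => f y * g y)
    (hf.hasFDerivAt.mul hg.hasFDerivAt)).trans ?_
  simp [pd]
  ring

lemma pd_add_smul (y : EuclideanSpace ℝ (Fin m)) (t : ℝ)
    (hf : DifferentiableAt ℝ f (y + t • x)) :
    pd i (fun z => f (y + t • z)) x = t * pd i f (y + t • x) := by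
  have h : HasFDerivAt (fun z : EuclideanSpace ℝ (Fin m) => y + t • z)
      (t • ContinuousLinearMap.id ℝ (EuclideanSpace ℝ (Fin m))) x :=
    ((hasFDerivAt_id x).const_smul t).const_add y
  refine (HasFDerivAt.pd_eq (f := fun z => f (y + t • z))
    (HasFDerivAt.comp x hf.hasFDerivAt h)).trans ?_
  simp [pd]

lemma pd_comp {h : ℝ → ℝ} (hh : DifferentiableAt ℝ h (f x)) (hf : DifferentiableAt ℝ f x) :
    pd i (fun y => h (f y)) x = deriv h (f x) * pd i f x := by
  refine (HasFDerivAt.pd_eq (f := fun y => h (f y))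
    (hh.hasDerivAt.comp_hasFDerivAt x hf.hasFDerivAt)).trans ?_
  simp [pd]

lemma fderiv_apply_eq_sum_pd (v : EuclideanSpace ℝ (Fin m)) :
    fderiv ℝ f x v = ∑ i, pd i f x * v i := by
  conv_lhs => rw [← (EuclideanSpace.basisFun (Fin m) ℝ).sum_repr v]
  simp [pd, mul_comm]

lemma ContDiff.pd {n : WithTop ℕ∞} {k : WithTop ℕ∞} (hf : ContDiff ℝ n f) (h : k + 1 ≤ n) :
    ContDiff ℝ k (pd i f) :=
  (hf.fderiv_right h).clm_apply contDiff_const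

lemma integral_pd_eq_zero (hf : ContDiff ℝ 1 f) (hc : HasCompactSupport f) :
    ∫ z, pd i f z = 0 := by
  have hd := hf.differentiable one_ne_zero
  have hi : Integrable (_root_.pd i f) :=
    (hf.pd (k := 0) (by simp)).continuous.integrable_of_hasCompactSupport
      (hc.fderiv_apply ℝ _)
  have := integral_mul_fderiv_eq_neg_fderiv_mul_of_integrable (μ := volume)
    (f := fun _ : EuclideanSpace ℝ (Fin m) => (1 : ℝ)) (g := f)
    (v := EuclideanSpace.single i 1) (by simp) (by simp only [one_mul]; exact hi)
    (by simpa using hf.continuous.integrable_of_hasCompactSupport hc)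
    (fun x _ => differentiableAt_const _) (fun x _ => hd x)
  simpa [_root_.pd] using this

end PartialDerivatives

section Profile

lemma exists_smooth_profile : ∃ h : ℝ → ℝ, ContDiff ℝ (⊤ : ℕ∞) h ∧ (∀ s ≤ 0, h s = 0) ∧
    (∀ s, 0 ≤ h s) ∧ (∀ s, 0 ≤ deriv h s) ∧ ∀ s, 0 < s → 0 < deriv h s := by
  refine ⟨expNegInvGlue, expNegInvGlue.contDiff, fun s hs => expNegInvGlue.zero_of_nonpos hs,
    expNegInvGlue.nonneg, fun s => expNegInvGlue.monotone.deriv_nonneg, fun s hs => ?_⟩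
  have := (expNegInvGlue.hasDerivAt_polynomial_eval_inv_mul 1 s).deriv
  simp only [Polynomial.eval_one, one_mul] at this
  rw [this]
  simp only [Polynomial.derivative_one, sub_zero, mul_one, Polynomial.eval_pow, Polynomial.eval_X]
  have := expNegInvGlue.pos_of_pos hs
  positivity

lemma deriv_eq_zero_of_forall_nonpos {h : ℝ → ℝ} (hc : ContDiff ℝ 1 h) (h0 : ∀ s ≤ 0, h s = 0)
    (s : ℝ) (hs : s ≤ 0) : deriv h s = 0 := by
  have h1 : EqOn (deriv h) 0 (closure (Iio 0)) := by
    refine EqOn.closure ?_ (hc.continuous_deriv le_rfl) continuous_const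
    intro t ht
    have : h =ᶠ[nhds t] fun _ => 0 := by
      filter_upwards [Iio_mem_nhds ht] with u hu using h0 u (le_of_lt hu)
    simp [this.deriv_eq]
  rw [closure_Iio] at h1
  exact h1 hs

lemma exists_abs_le_of_continuous_of_nonpos {h : ℝ → ℝ} (hc : Continuous h)
    (h0 : ∀ s ≤ 0, h s = 0) : ∃ H, 0 < H ∧ ∀ s ≤ 1, |h s| ≤ H := by
  obtain ⟨H, hH⟩ := (isCompact_Icc (a := (0 : ℝ)) (b := 1)).exists_bound_of_continuousOn
    hc.continuousOn
  refine ⟨max H 1, by positivity, fun s hs => ?_⟩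
  rcases le_total s 0 with h | h
  · rw [h0 s h]; simp
  · exact (hH s ⟨h, hs⟩).trans (le_max_left _ _)

end Profile

section EllipticInverse

open Matrix

variable {m : ℕ} {e A : ℝ} {P : Matrix (Fin m) (Fin m) ℝ}

lemma isUnit_det_of_elliptic (he : 0 < e)
    (hell : ∀ ξ : Fin m → ℝ, e * ∑ i, (ξ i) ^ 2 ≤ ∑ i, ∑ j, P i j * ξ i * ξ j) :
    IsUnit P.det := by
  rw [isUnit_iff_ne_zero]
  intro h0
  obtain ⟨v, hv, hPv⟩ := Matrix.exists_mulVec_eq_zero_iff.2 h0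
  apply hv
  have h1 := hell v
  have h2 : ∑ i, ∑ j, P i j * v i * v j = 0 := by
    refine Finset.sum_eq_zero fun i _ => ?_
    have := congrFun hPv i
    simp only [mulVec, dotProduct, Pi.zero_apply] at this
    calc ∑ j, P i j * v i * v j = v i * ∑ j, P i j * v j := by
          rw [Finset.mul_sum]; exact Finset.sum_congr rfl fun j _ => by ring
      _ = 0 := by rw [this, mul_zero]
  rw [h2] at h1
  have h3 : ∑ i, (v i) ^ 2 = 0 :=
    le_antisymm (by nlinarith) (Finset.sum_nonneg fun i _ => sq_nonneg _)
  funext i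
  have := (Finset.sum_eq_zero_iff_of_nonneg fun i _ => sq_nonneg (v i)).1 h3 i (Finset.mem_univ i)
  simpa using this

lemma elliptic_inverse_bounds (he : 0 < e)
    (hell : ∀ ξ : Fin m → ℝ, e * ∑ i, (ξ i) ^ 2 ≤ ∑ i, ∑ j, P i j * ξ i * ξ j)
    (hA : ∀ i j, |P i j| ≤ A) (z : Fin m → ℝ) :
    ∑ i, (P⁻¹ *ᵥ z) i ^ 2 ≤ (∑ i, z i ^ 2) / e ^ 2 ∧
    ∑ i, z i * (P⁻¹ *ᵥ z) i ≤ (∑ i, z i ^ 2) / e ∧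
    ∑ i, z i ^ 2 ≤ m ^ 2 * A ^ 2 / e * ∑ i, z i * (P⁻¹ *ᵥ z) i := by
  have hu := isUnit_det_of_elliptic he hell
  set u := P⁻¹ *ᵥ z with hudef
  have hPu : P *ᵥ u = z := by
    rw [hudef, mulVec_mulVec, mul_nonsing_inv _ hu, one_mulVec]
  have h1 : e * ∑ i, u i ^ 2 ≤ ∑ i, z i * u i := by
    refine (hell u).trans_eq (Finset.sum_congr rfl fun i _ => ?_)
    rw [← congrFun hPu i, mulVec, dotProduct, Finset.sum_mul]
    exact Finset.sum_congr rfl fun j _ => by ring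
  have h2 : ∑ i, z i * u i ≤ e / 2 * ∑ i, u i ^ 2 + 1 / (2 * e) * ∑ i, z i ^ 2 := by
    rw [Finset.mul_sum, Finset.mul_sum, ← Finset.sum_add_distrib]
    refine Finset.sum_le_sum fun i _ => ?_
    have : 0 ≤ (e * u i - z i) ^ 2 / (2 * e) := by positivity
    have h' : (e * u i - z i) ^ 2 / (2 * e)
        = e / 2 * u i ^ 2 + 1 / (2 * e) * z i ^ 2 - z i * u i := by
      field_simp; ring
    linarith
  have h3 : ∑ i, u i ^ 2 ≤ (∑ i, z i ^ 2) / e ^ 2 := by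
    rw [le_div_iff₀ (by positivity)]
    have : e / 2 * ∑ i, u i ^ 2 ≤ 1 / (2 * e) * ∑ i, z i ^ 2 := by linarith
    have h' := mul_le_mul_of_nonneg_left this (show 0 ≤ 2 * e by positivity)
    have e1 : 2 * e * (1 / (2 * e) * ∑ i, z i ^ 2) = ∑ i, z i ^ 2 := by field_simp
    rw [e1] at h'
    linarith
  refine ⟨h3, ?_, ?_⟩
  · have h4 := mul_le_mul_of_nonneg_left h3 (show 0 ≤ e / 2 by positivity)
    calc ∑ i, z i * u i
        ≤ e / 2 * ((∑ i, z i ^ 2) / e ^ 2) + 1 / (2 * e) * ∑ i, z i ^ 2 := by linarith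
      _ = (∑ i, z i ^ 2) / e := by field_simp; ring
  · have h4 : ∀ i, z i ^ 2 ≤ m * A ^ 2 * ∑ j, u j ^ 2 := by
      intro i
      rw [← congrFun hPu i]
      refine (Finset.sum_mul_sq_le_sq_mul_sq Finset.univ (P i) u).trans ?_
      refine mul_le_mul_of_nonneg_right ?_ (Finset.sum_nonneg fun i _ => sq_nonneg _)
      calc ∑ j, P i j ^ 2 ≤ ∑ _j : Fin m, A ^ 2 := Finset.sum_le_sum fun j _ => by
            rw [← sq_abs]; exact pow_le_pow_left₀ (abs_nonneg _) (hA i j) 2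
        _ = m * A ^ 2 := by simp
    calc ∑ i, z i ^ 2 ≤ ∑ _i : Fin m, m * A ^ 2 * ∑ j, u j ^ 2 :=
          Finset.sum_le_sum fun i _ => h4 i
      _ = m ^ 2 * A ^ 2 / e * (e * ∑ j, u j ^ 2) := by simp; field_simp
      _ ≤ _ := mul_le_mul_of_nonneg_left h1 (by positivity)

end EllipticInverse

section Kernel

/-- A kernel adapted to the frozen coefficient matrix `P`: the fields satisfy
`∇ψ = -Φ` and `P Φ = φ · id`, so that the derivative in `t` of the weighted means
`∫ w (y + t z) φ z` is a divergence-form expression in `w`. -/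
structure IsMeanValueKernel {m : ℕ} (P : Matrix (Fin m) (Fin m) ℝ) (R H κ : ℝ)
    (ψ φ : EuclideanSpace ℝ (Fin m) → ℝ) (Φ : Fin m → EuclideanSpace ℝ (Fin m) → ℝ) : Prop where
  contDiff_potential : ContDiff ℝ 1 ψ
  contDiff_weight : ContDiff ℝ 1 φ
  contDiff_field : ∀ i, ContDiff ℝ 1 (Φ i)
  potential_nonneg : ∀ z, 0 ≤ ψ z
  potential_le : ∀ z, ψ z ≤ H
  weight_nonneg : ∀ z, 0 ≤ φ z
  weight_le : ∀ z, φ z ≤ H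
  abs_field_le : ∀ i z, |Φ i z| ≤ H
  abs_pd_field_le : ∀ i j z, |pd j (Φ i) z| ≤ H
  potential_eq_zero : ∀ z, R < ‖z‖ → ψ z = 0
  weight_eq_zero : ∀ z, R < ‖z‖ → φ z = 0
  field_eq_zero : ∀ i z, R < ‖z‖ → Φ i z = 0
  pd_field_eq_zero : ∀ i j z, R < ‖z‖ → pd j (Φ i) z = 0
  pd_potential : ∀ i z, pd i ψ z = -Φ i z
  sum_field_mul : ∀ j z, ∑ i, Φ i z * P i j = z j * φ z
  le_integral_weight : κ ≤ ∫ z, φ z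

open Matrix

lemma exists_isMeanValueKernel (m : ℕ) {e A : ℝ} (he : 0 < e) :
    ∃ R H κ : ℝ, 0 < R ∧ 0 < H ∧ 0 < κ ∧ ∀ P : Matrix (Fin m) (Fin m) ℝ,
      (∀ i j, P i j = P j i) →
      (∀ ξ : Fin m → ℝ, e * ∑ i, (ξ i) ^ 2 ≤ ∑ i, ∑ j, P i j * ξ i * ξ j) →
      (∀ i j, |P i j| ≤ A) →
      ∃ ψ φ Φ, IsMeanValueKernel P R H κ ψ φ Φ := by
  obtain ⟨h, hsm, hz, hnn, hd, hdpos⟩ := exists_smooth_profile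
  have hc1 : ContDiff ℝ 1 h := hsm.of_le (by exact_mod_cast le_top)
  have hsm' : ContDiff ℝ (⊤ : ℕ∞) (deriv h) := ((contDiff_infty_iff_deriv).1 hsm).2
  have hc1' : ContDiff ℝ 1 (deriv h) := hsm'.of_le (by exact_mod_cast le_top)
  have hz' := deriv_eq_zero_of_forall_nonpos hc1 hz
  have hz'' := deriv_eq_zero_of_forall_nonpos hc1' hz'
  obtain ⟨H0, hH0, hb0⟩ := exists_abs_le_of_continuous_of_nonpos hc1.continuous hz
  obtain ⟨H1, hH1, hb1⟩ := exists_abs_le_of_continuous_of_nonpos hc1'.continuous hz'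
  obtain ⟨H2, hH2, hb2⟩ := exists_abs_le_of_continuous_of_nonpos
    (hc1'.continuous_deriv le_rfl) hz''
  obtain ⟨s0, hs0, hmin⟩ := (isCompact_Icc (a := (1 / 2 : ℝ)) (b := 1)).exists_isMinOn
    ⟨1, by norm_num⟩ hc1'.continuous.continuousOn
  have hκ0 : 0 < deriv h s0 := hdpos s0 (by linarith [hs0.1])
  set R : ℝ := Real.sqrt (m ^ 2 * A ^ 2 / e) + 1 with hR
  have hRpos : 0 < R := by positivity
  set B : ℝ := R / e
  have hBpos : 0 < B := by positivity
  set ρ : ℝ := Real.sqrt (e / 2) with hρ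
  have hρpos : 0 < ρ := by positivity
  set vol : ℝ := volume.real (Metric.closedBall (0 : EuclideanSpace ℝ (Fin m)) ρ) with hvol
  have hvolpos : 0 < vol := by
    rw [hvol, measureReal_def]
    exact ENNReal.toReal_pos (Metric.measure_closedBall_pos _ _ hρpos).ne'
      measure_closedBall_lt_top.ne
  refine ⟨R, H0 + 2 * H1 + 2 * H1 * B + (2 * H1 / e + 4 * H2 * B ^ 2), 2 * deriv h s0 * vol,
    hRpos, by positivity, by positivity, fun P hsym hell hA => ?_⟩
  set Q := P⁻¹ with hQdef
  have hdet := isUnit_det_of_elliptic he hell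
  have hQsym : ∀ i j, Q i j = Q j i := by
    have hPt : Pᵀ = P := by ext i j; exact hsym j i
    have : Qᵀ = Q := by rw [hQdef, transpose_nonsing_inv, hPt]
    intro i j
    exact congrFun (congrFun this j) i
  have hQP : Q * P = 1 := nonsing_inv_mul P hdet
  set L : Fin m → EuclideanSpace ℝ (Fin m) → ℝ := fun i z => ∑ j, Q i j * z j with hL
  set q : EuclideanSpace ℝ (Fin m) → ℝ := fun z => ∑ i, z i * L i z with hq
  have hbounds : ∀ z : EuclideanSpace ℝ (Fin m),
      ∑ i, L i z ^ 2 ≤ ‖z‖ ^ 2 / e ^ 2 ∧ q z ≤ ‖z‖ ^ 2 / e ∧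
      ‖z‖ ^ 2 ≤ m ^ 2 * A ^ 2 / e * q z := by
    intro z
    rw [EuclideanSpace.real_norm_sq_eq]
    exact elliptic_inverse_bounds he hell hA z.ofLp
  have hLb : ∀ i z, |L i z| ≤ ‖z‖ / e := by
    intro i z
    refine abs_le_of_sq_le_sq ?_ (by positivity)
    rw [div_pow]
    exact (Finset.single_le_sum (f := fun i => L i z ^ 2) (fun i _ => sq_nonneg _)
      (Finset.mem_univ i)).trans (hbounds z).1
  have hQb : ∀ i j, |Q i j| ≤ 1 / e := by
    intro i j
    have := hLb i (EuclideanSpace.single j 1)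
    simpa [hL] using this
  have hq0 : ∀ z, 0 ≤ q z := by
    intro z
    by_contra! hneg
    have := (hbounds z).2.2
    have h2 : (m : ℝ) ^ 2 * A ^ 2 / e * q z ≤ 0 :=
      mul_nonpos_of_nonneg_of_nonpos (by positivity) hneg.le
    have h3 : ‖z‖ = 0 := by
      have : ‖z‖ ^ 2 = 0 := le_antisymm (this.trans h2) (sq_nonneg _)
      simpa using this
    have h4 : z = 0 := norm_eq_zero.1 h3
    rw [h4] at hneg
    simp [hq] at hneg
  have hqR : ∀ z, R < ‖z‖ → 1 - q z ≤ 0 := by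
    intro z hzR
    by_contra! hlt
    have h1 := (hbounds z).2.2
    have h2 : (m : ℝ) ^ 2 * A ^ 2 / e * q z ≤ m ^ 2 * A ^ 2 / e :=
      mul_le_of_le_one_right (by positivity) (by linarith)
    have h3 : ‖z‖ ≤ Real.sqrt (m ^ 2 * A ^ 2 / e) := Real.le_sqrt_of_sq_le (h1.trans h2)
    linarith
  have hLsm : ∀ i, ContDiff ℝ 1 (L i) := by intro i; simp only [hL]; fun_prop
  have hqsm : ContDiff ℝ 1 q := by simp only [hq]; fun_prop
  have hcoord : ∀ (k : Fin m) (z : EuclideanSpace ℝ (Fin m)), HasFDerivAt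
      (fun z : EuclideanSpace ℝ (Fin m) => z k)
      (EuclideanSpace.proj k : EuclideanSpace ℝ (Fin m) →L[ℝ] ℝ) z :=
    fun k z => (EuclideanSpace.proj k : EuclideanSpace ℝ (Fin m) →L[ℝ] ℝ).hasFDerivAt
  have hLd : ∀ i z, HasFDerivAt (L i) (∑ j, Q i j • (EuclideanSpace.proj j :
      EuclideanSpace ℝ (Fin m) →L[ℝ] ℝ)) z := by
    intro i z
    simp only [hL]
    exact HasFDerivAt.fun_sum fun j _ => (hcoord j z).const_mul (Q i j)
  have hLpd : ∀ i j z, pd j (L i) z = Q i j := by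
    intro i j z
    rw [(hLd i z).pd_eq]
    simp
  have hqpd : ∀ i z, pd i q z = 2 * L i z := by
    intro i z
    have : HasFDerivAt q (∑ k, (z k • (∑ j, Q k j • (EuclideanSpace.proj j :
        EuclideanSpace ℝ (Fin m) →L[ℝ] ℝ)) +
        L k z • (EuclideanSpace.proj k : EuclideanSpace ℝ (Fin m) →L[ℝ] ℝ))) z :=
      HasFDerivAt.fun_sum fun k _ =>
        (hcoord k z).mul (hLd k z)
    rw [this.pd_eq]
    simp only [_root_.sum_apply, _root_.add_apply]
    simp [Finset.sum_add_distrib]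
    have : ∑ k, z k * Q k i = L i z :=
      Finset.sum_congr rfl fun k _ => by rw [hQsym k i]; ring
    rw [this]; ring
  have h1q : ContDiff ℝ 1 fun z => 1 - q z := contDiff_const.sub hqsm
  have h1qpd : ∀ i z, pd i (fun z => 1 - q z) z = - (2 * L i z) := by
    intro i z
    have := HasFDerivAt.pd_eq (i := i)
      (((hqsm.differentiable one_ne_zero z).hasFDerivAt).const_sub 1)
    rw [this, ← hqpd]
    simp [pd]
  have hcomp : ∀ {g : ℝ → ℝ}, ContDiff ℝ 1 g → ∀ i z,
      pd i (fun z => g (1 - q z)) z = - (2 * deriv g (1 - q z) * L i z) := by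
    intro g hg i z
    rw [pd_comp (f := fun z => 1 - q z) (hg.differentiable one_ne_zero _)
      (h1q.differentiable one_ne_zero _), h1qpd]
    ring
  have hφsm : ContDiff ℝ 1 fun z => 2 * deriv h (1 - q z) := contDiff_const.mul (hc1'.comp h1q)
  have hΦpd : ∀ i j z, pd j (fun z => 2 * deriv h (1 - q z) * L i z) z =
      2 * deriv h (1 - q z) * Q i j - 4 * deriv (deriv h) (1 - q z) * L i z * L j z := by
    intro i j z
    rw [pd_mul (hφsm.differentiable one_ne_zero _) ((hLsm i).differentiable one_ne_zero _), hLpd,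
      pd_mul (f := fun _ => 2) (g := fun z => deriv h (1 - q z)) (differentiableAt_const _)
        ((hc1'.comp h1q).differentiable one_ne_zero _), hcomp hc1']
    simp [pd]
    ring
  have hle1 : ∀ z, 1 - q z ≤ 1 := fun z => by linarith [hq0 z]
  have hb0' : ∀ z, h (1 - q z) ≤ H0 := fun z => (le_abs_self _).trans (hb0 _ (hle1 z))
  have hb1' : ∀ z, |2 * deriv h (1 - q z)| ≤ 2 * H1 := fun z => by
    rw [abs_mul, abs_two]; exact mul_le_mul_of_nonneg_left (hb1 _ (hle1 z)) zero_le_two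
  have hLB : ∀ i z, ‖z‖ ≤ R → |L i z| ≤ B := fun i z hzR =>
    (hLb i z).trans (div_le_div_of_nonneg_right hzR he.le)
  refine ⟨fun z => h (1 - q z), fun z => 2 * deriv h (1 - q z),
    fun i z => 2 * deriv h (1 - q z) * L i z, ?_⟩
  have hH : 0 ≤ 2 * H1 / e + 4 * H2 * B ^ 2 := by positivity
  have hH' : 0 ≤ 2 * H1 * B := by positivity
  constructor
  · exact hc1.comp h1q
  · exact hφsm
  · exact fun i => hφsm.mul (hLsm i)
  · exact fun z => hnn _
  · exact fun z => by linarith [hb0' z]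
  · exact fun z => mul_nonneg zero_le_two (hd _)
  · exact fun z => by linarith [(le_abs_self _).trans (hb1' z)]
  · intro i z
    rcases lt_or_ge R ‖z‖ with hzR | hzR
    · rw [hz' _ (hqR z hzR)]; simp; positivity
    · rw [abs_mul]
      have := mul_le_mul (hb1' z) (hLB i z hzR) (abs_nonneg _) (by positivity)
      linarith
  · intro i j z
    rw [hΦpd]
    rcases lt_or_ge R ‖z‖ with hzR | hzR
    · rw [hz' _ (hqR z hzR), hz'' _ (hqR z hzR)]; simp; positivity
    · have e1 : |2 * deriv h (1 - q z) * Q i j| ≤ 2 * H1 * (1 / e) := by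
        rw [abs_mul]
        exact mul_le_mul (hb1' z) (hQb i j) (abs_nonneg _) (by positivity)
      have e2 : |4 * deriv (deriv h) (1 - q z) * L i z * L j z| ≤ 4 * H2 * B * B := by
        rw [abs_mul, abs_mul, abs_mul, abs_of_pos (by norm_num : (0 : ℝ) < 4)]
        have := hb2 _ (hle1 z)
        have := hLB i z hzR
        have := hLB j z hzR
        gcongr
      have e3 : 2 * H1 * (1 / e) + 4 * H2 * B * B = 2 * H1 / e + 4 * H2 * B ^ 2 := by ring
      refine (abs_sub _ _).trans ?_
      linarith
  · exact fun z hzR => hz _ (hqR z hzR)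
  · exact fun z hzR => by simp [hz' _ (hqR z hzR)]
  · exact fun i z hzR => by simp [hz' _ (hqR z hzR)]
  · intro i j z hzR
    rw [hΦpd, hz' _ (hqR z hzR), hz'' _ (hqR z hzR)]; simp
  · exact fun i z => hcomp hc1 i z
  · intro j z
    have : ∑ i, L i z * P i j = z j := by
      have hPQ : ∀ k, ∑ i, Q k i * P i j = if k = j then 1 else 0 := by
        intro k
        rw [← Matrix.mul_apply, hQP, Matrix.one_apply]
      calc ∑ i, L i z * P i j = ∑ i, ∑ k, z k * (Q k i * P i j) := by
            refine Finset.sum_congr rfl fun i _ => ?_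
            rw [Finset.sum_mul]
            exact Finset.sum_congr rfl fun k _ => by rw [hQsym i k]; ring
        _ = ∑ k, z k * ∑ i, Q k i * P i j := by
            rw [Finset.sum_comm]
            exact Finset.sum_congr rfl fun k _ => by rw [Finset.mul_sum]
        _ = z j := by simp [hPQ]
    rw [← this, Finset.sum_mul]
    exact Finset.sum_congr rfl fun i _ => by ring
  · have hcs : HasCompactSupport fun z => 2 * deriv h (1 - q z) :=
      HasCompactSupport.intro (isCompact_closedBall (0 : EuclideanSpace ℝ (Fin m)) R)
        fun z hzR => by
          have : R < ‖z‖ := by simpa using hzR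
          simp [hz' _ (hqR z this)]
    have hint := hφsm.continuous.integrable_of_hasCompactSupport (μ := volume) hcs
    calc 2 * deriv h s0 * vol
        = ∫ _z in Metric.closedBall (0 : EuclideanSpace ℝ (Fin m)) ρ, 2 * deriv h s0 := by
          rw [setIntegral_const, smul_eq_mul, mul_comm]
      _ ≤ ∫ z in Metric.closedBall (0 : EuclideanSpace ℝ (Fin m)) ρ,
            2 * deriv h (1 - q z) := by
          refine setIntegral_mono_on (integrableOn_const measure_closedBall_lt_top.ne)
            hint.integrableOn measurableSet_closedBall fun z hzρ => ?_
          have hzρ : ‖z‖ ≤ ρ := by simpa using hzρ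
          have : q z ≤ 1 / 2 := by
            refine (hbounds z).2.1.trans ?_
            rw [div_le_iff₀ he]
            have := pow_le_pow_left₀ (norm_nonneg _) hzρ 2
            rw [hρ, Real.sq_sqrt (by positivity)] at this
            linarith
          exact mul_le_mul_of_nonneg_left
            (hmin (show 1 - q z ∈ Icc (1 / 2 : ℝ) 1 from ⟨by linarith, hle1 z⟩)) zero_le_two
      _ ≤ ∫ z, 2 * deriv h (1 - q z) :=
          setIntegral_le_integral hint
            (Filter.Eventually.of_forall fun z => mul_nonneg zero_le_two (hd _))

end Kernel

section MeanValue

open Matrix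

variable {m : ℕ}

lemma hasDerivAt_integral_comp_add_smul_mul {w φ : EuclideanSpace ℝ (Fin m) → ℝ} {R : ℝ}
    (hw : ContDiff ℝ 1 w) (hφ : Continuous φ) (hφ0 : ∀ z, R < ‖z‖ → φ z = 0)
    (y : EuclideanSpace ℝ (Fin m)) (t : ℝ) :
    HasDerivAt (fun t : ℝ => ∫ z, w (y + t • z) * φ z)
      (∫ z, fderiv ℝ w (y + t • z) z * φ z) t := by
  have hsupp : ∀ g : EuclideanSpace ℝ (Fin m) → ℝ, HasCompactSupport fun z => g z * φ z :=
    fun g => HasCompactSupport.intro (isCompact_closedBall (0 : EuclideanSpace ℝ (Fin m)) R)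
      fun z hz => by
        have : R < ‖z‖ := by simpa using hz
        simp [hφ0 z this]
  have hfd := hw.continuous_fderiv one_ne_zero
  have hcont : Continuous fun p : ℝ × EuclideanSpace ℝ (Fin m) =>
      fderiv ℝ w (y + p.1 • p.2) p.2 * φ p.2 := by fun_prop
  obtain ⟨M, hM⟩ := ((isCompact_Icc (a := t - 1) (b := t + 1)).prod
    (isCompact_closedBall (0 : EuclideanSpace ℝ (Fin m)) R)).exists_bound_of_continuousOn
      hcont.continuousOn
  have hwc := hw.continuous
  have hF : ∀ τ : ℝ, Continuous fun z => w (y + τ • z) * φ z := fun τ => by fun_prop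
  refine (hasDerivAt_integral_of_dominated_loc_of_deriv_le (s := Icc (t - 1) (t + 1))
    (bound := (Metric.closedBall (0 : EuclideanSpace ℝ (Fin m)) R).indicator fun _ => M)
    (F' := fun τ z => fderiv ℝ w (y + τ • z) z * φ z)
    (Icc_mem_nhds (by linarith) (by linarith))
    (Filter.Eventually.of_forall fun τ => (hF τ).aestronglyMeasurable)
    ((hF t).integrable_of_hasCompactSupport (hsupp _))
    (by
      have : Continuous fun z => fderiv ℝ w (y + t • z) z * φ z := by fun_prop
      exact this.aestronglyMeasurable)
    (Filter.Eventually.of_forall fun z τ hτ => ?_)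
    ((integrableOn_const measure_closedBall_lt_top.ne).integrable_indicator
      measurableSet_closedBall)
    (Filter.Eventually.of_forall fun z τ _ => ?_)).2
  · by_cases hz : z ∈ Metric.closedBall (0 : EuclideanSpace ℝ (Fin m)) R
    · rw [indicator_of_mem hz]
      exact hM (τ, z) ⟨hτ, hz⟩
    · have : R < ‖z‖ := by simpa using hz
      simp [hφ0 z this, hz]
  · have h1 : HasDerivAt (fun τ : ℝ => y + τ • z) z τ := by
      simpa using ((hasDerivAt_id τ).smul_const z).const_add y
    exact (((hw.differentiable one_ne_zero _).hasFDerivAt).comp_hasDerivAt τ h1).mul_const _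

lemma IsMeanValueKernel.le_mul_integral_fderiv_mul
    {a : EuclideanSpace ℝ (Fin m) → Fin m → Fin m → ℝ}
    {w ψ φ : EuclideanSpace ℝ (Fin m) → ℝ} {Φ : Fin m → EuclideanSpace ℝ (Fin m) → ℝ}
    {y : EuclideanSpace ℝ (Fin m)} {P : Matrix (Fin m) (Fin m) ℝ} {R H κ A Λ N t : ℝ}
    (hker : IsMeanValueKernel P R H κ ψ φ Φ)
    (ha : ∀ i j, ContDiff ℝ 1 fun x => a x i j) (hw : ContDiff ℝ 2 w)
    (ht : 0 < t) (hH : 0 ≤ H) (hA : 0 ≤ A) (hΛ : 0 ≤ Λ)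
    (hpd : ∀ x ∈ Metric.closedBall y (t * R), ∀ i j k, |pd k (fun x => a x i j) x| ≤ A)
    (hP : ∀ x ∈ Metric.closedBall y (t * R), ∀ i j, |a x i j - P i j| ≤ A * (t * R))
    (hw0 : ∀ x ∈ Metric.closedBall y (t * R), 0 ≤ w x ∧ w x ≤ N)
    (hsub : ∀ x ∈ Metric.closedBall y (t * R),
      -Λ * w x ≤ ∑ i, pd i (fun y => ∑ j, a y i j * pd j w y) x) :
    -((t * (Λ * H) + m ^ 2 * (A * H + A * R * H)) * N *
      volume.real (Metric.closedBall (0 : EuclideanSpace ℝ (Fin m)) R)) ≤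
      ∫ z, fderiv ℝ w (y + t • z) z * φ z := by
  set g : Fin m → EuclideanSpace ℝ (Fin m) → ℝ := fun i x => ∑ j, a x i j * pd j w x with hg
  have hw1 : ContDiff ℝ 1 w := hw.of_le (by norm_num)
  have hpw : ∀ j, ContDiff ℝ 1 (pd j w) := fun j => hw.pd (by norm_num)
  have hg1 : ∀ i, ContDiff ℝ 1 (g i) := fun i =>
    ContDiff.sum fun j _ => (ha i j).mul (hpw j)
  have hline : ContDiff ℝ 1 fun z : EuclideanSpace ℝ (Fin m) => y + t • z := by fun_prop
  set G : Fin m → EuclideanSpace ℝ (Fin m) → ℝ := fun i z => g i (y + t • z) * ψ z with hG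
  set V : Fin m → Fin m → EuclideanSpace ℝ (Fin m) → ℝ :=
    fun i j z => (a (y + t • z) i j - P i j) * Φ i z with hV
  set W : Fin m → Fin m → EuclideanSpace ℝ (Fin m) → ℝ :=
    fun i j z => w (y + t • z) * V i j z with hW
  have hG1 : ∀ i, ContDiff ℝ 1 (G i) := fun i => ((hg1 i).comp hline).mul hker.contDiff_potential
  have hb1 : ∀ i j, ContDiff ℝ 1 fun z => a (y + t • z) i j - P i j := fun i j =>
    ((ha i j).comp hline).sub contDiff_const
  have hV1 : ∀ i j, ContDiff ℝ 1 (V i j) := fun i j => (hb1 i j).mul (hker.contDiff_field i)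
  have hW1 : ∀ i j, ContDiff ℝ 1 (W i j) := fun i j => (hw1.comp hline).mul (hV1 i j)
  have hsupp : ∀ f : EuclideanSpace ℝ (Fin m) → ℝ, (∀ z, R < ‖z‖ → f z = 0) →
      HasCompactSupport f := fun f hf =>
    HasCompactSupport.intro (isCompact_closedBall (0 : EuclideanSpace ℝ (Fin m)) R)
      fun z hz => hf z (by simpa using hz)
  have hGs : ∀ i, HasCompactSupport (G i) := fun i => hsupp _ fun z hz => by
    simp [hG, hker.potential_eq_zero z hz]
  have hWs : ∀ i j, HasCompactSupport (W i j) := fun i j => hsupp _ fun z hz => by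
    simp [hW, hV, hker.field_eq_zero i z hz]
  have hGpd : ∀ i z, pd i (G i) z = t * pd i (g i) (y + t • z) * ψ z - g i (y + t • z) * Φ i z := by
    intro i z
    rw [hG]
    simp only
    rw [pd_mul (f := fun z => g i (y + t • z))
      (((hg1 i).comp hline).differentiable one_ne_zero _)
      (hker.contDiff_potential.differentiable one_ne_zero _),
      pd_add_smul y t ((hg1 i).differentiable one_ne_zero _), hker.pd_potential]
    ring
  have hbpd : ∀ i j z, pd j (fun z => a (y + t • z) i j - P i j) z =
      t * pd j (fun x => a x i j) (y + t • z) := by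
    intro i j z
    rw [← pd_add_smul (f := fun x => a x i j) y t ((ha i j).differentiable one_ne_zero _)]
    simp [pd, fderiv_sub_const]
  have hVpd : ∀ i j z, pd j (V i j) z = t * pd j (fun x => a x i j) (y + t • z) * Φ i z +
      (a (y + t • z) i j - P i j) * pd j (Φ i) z := by
    intro i j z
    rw [hV]
    simp only
    rw [pd_mul ((hb1 i j).differentiable one_ne_zero _)
      ((hker.contDiff_field i).differentiable one_ne_zero _), hbpd]
  have hWpd : ∀ i j z, pd j (W i j) z =
      t * pd j w (y + t • z) * V i j z + w (y + t • z) * pd j (V i j) z := by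
    intro i j z
    rw [hW]
    simp only
    rw [pd_mul (f := fun z => w (y + t • z)) ((hw1.comp hline).differentiable one_ne_zero _)
      ((hV1 i j).differentiable one_ne_zero _),
      pd_add_smul y t (hw1.differentiable one_ne_zero _)]
  have hkey : ∀ z, t * (fderiv ℝ w (y + t • z) z * φ z) + t * ∑ i, pd i (G i) z +
      ∑ i, ∑ j, pd j (W i j) z =
      t ^ 2 * ψ z * ∑ i, pd i (g i) (y + t • z) + w (y + t • z) * ∑ i, ∑ j, pd j (V i j) z := by
    intro z
    have h1 : fderiv ℝ w (y + t • z) z * φ z =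
        ∑ i, ∑ j, pd j w (y + t • z) * Φ i z * P i j := by
      rw [fderiv_apply_eq_sum_pd, Finset.sum_mul, Finset.sum_comm]
      refine Finset.sum_congr rfl fun j _ => ?_
      rw [mul_assoc, ← hker.sum_field_mul j z, Finset.mul_sum]
      exact Finset.sum_congr rfl fun i _ => by ring
    rw [h1]
    simp only [hGpd, hWpd, Finset.mul_sum, ← Finset.sum_add_distrib]
    refine Finset.sum_congr rfl fun i _ => ?_
    have h2 : g i (y + t • z) * Φ i z = ∑ j, a (y + t • z) i j * pd j w (y + t • z) * Φ i z := by
      rw [hg, Finset.sum_mul]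
    rw [h2, mul_sub, Finset.mul_sum]
    have h3 : ∑ j, t * (pd j w (y + t • z) * Φ i z * P i j) +
        ∑ j, t * pd j w (y + t • z) * V i j z =
        ∑ j, t * (a (y + t • z) i j * pd j w (y + t • z) * Φ i z) := by
      rw [← Finset.sum_add_distrib]
      exact Finset.sum_congr rfl fun j _ => by simp only [hV]; ring
    rw [Finset.sum_add_distrib]
    linear_combination h3
  set C := t * (Λ * H) + m ^ 2 * (A * H + A * R * H) with hC
  have hlow : ∀ z, (Metric.closedBall (0 : EuclideanSpace ℝ (Fin m)) R).indicator
      (fun _ => -(t * (C * N))) z ≤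
      t ^ 2 * ψ z * ∑ i, pd i (g i) (y + t • z) + w (y + t • z) * ∑ i, ∑ j, pd j (V i j) z := by
    intro z
    by_cases hz : z ∈ Metric.closedBall (0 : EuclideanSpace ℝ (Fin m)) R
    · rw [indicator_of_mem hz]
      have hzR : ‖z‖ ≤ R := by simpa using hz
      have hx : y + t • z ∈ Metric.closedBall y (t * R) := by
        rw [Metric.mem_closedBall, dist_eq_norm, add_sub_cancel_left, norm_smul,
          Real.norm_of_nonneg ht.le]
        exact mul_le_mul_of_nonneg_left hzR ht.le
      have hR : 0 ≤ R := (norm_nonneg _).trans hzR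
      obtain ⟨hwx, hwN⟩ := hw0 _ hx
      have hN : 0 ≤ N := hwx.trans hwN
      have hψ0 := hker.potential_nonneg z
      have hψH := hker.potential_le z
      have h1 : -(t ^ 2 * (Λ * H) * N) ≤ t ^ 2 * ψ z * ∑ i, pd i (g i) (y + t • z) := by
        have := mul_le_mul_of_nonneg_left (hsub _ hx) (show 0 ≤ t ^ 2 * ψ z by positivity)
        refine le_trans ?_ this
        have h' : ψ z * (Λ * w (y + t • z)) ≤ H * (Λ * N) := by gcongr
        have := mul_le_mul_of_nonneg_left h' (sq_nonneg t)
        linarith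
      have h2 : |∑ i, ∑ j, pd j (V i j) z| ≤ m ^ 2 * (t * (A * H + A * R * H)) := by
        calc |∑ i, ∑ j, pd j (V i j) z| ≤ ∑ _i : Fin m, ∑ _j : Fin m, t * (A * H + A * R * H) := by
              refine (Finset.abs_sum_le_sum_abs _ _).trans (Finset.sum_le_sum fun i _ => ?_)
              refine (Finset.abs_sum_le_sum_abs _ _).trans (Finset.sum_le_sum fun j _ => ?_)
              rw [hVpd]
              refine (abs_add_le _ _).trans ?_
              have e1 : |t * pd j (fun x => a x i j) (y + t • z) * Φ i z| ≤ t * A * H := by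
                rw [abs_mul, abs_mul, abs_of_pos ht]
                have := hpd _ hx i j j
                have := hker.abs_field_le i z
                gcongr
              have e2 : |(a (y + t • z) i j - P i j) * pd j (Φ i) z| ≤ A * (t * R) * H := by
                rw [abs_mul]
                have := hP _ hx i j
                have := hker.abs_pd_field_le i j z
                gcongr
              linarith
          _ = m ^ 2 * (t * (A * H + A * R * H)) := by simp; ring
      have h3 : -(N * (m ^ 2 * (t * (A * H + A * R * H)))) ≤
          w (y + t • z) * ∑ i, ∑ j, pd j (V i j) z := by
        have := mul_le_mul hwN h2 (abs_nonneg _) hN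
        have h' := neg_abs_le (w (y + t • z) * ∑ i, ∑ j, pd j (V i j) z)
        rw [abs_mul, abs_of_nonneg hwx] at h'
        linarith
      rw [hC]
      linarith
    · have hzR : R < ‖z‖ := by simpa using hz
      rw [indicator_of_notMem hz, hker.potential_eq_zero z hzR]
      have : ∀ i j, pd j (V i j) z = 0 := fun i j => by
        rw [hVpd, hker.field_eq_zero i z hzR, hker.pd_field_eq_zero i j z hzR]; ring
      simp [this]
  have hfd := hw1.continuous_fderiv one_ne_zero
  have hφc := hker.contDiff_weight.continuous
  have hIT : Integrable fun z => fderiv ℝ w (y + t • z) z * φ z := by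
    refine Continuous.integrable_of_hasCompactSupport (by fun_prop) (hsupp _ fun z hz => ?_)
    simp [hker.weight_eq_zero z hz]
  have hIG : ∀ i, Integrable (pd i (G i)) := fun i =>
    ((hG1 i).pd (k := 0) (by simp)).continuous.integrable_of_hasCompactSupport
      ((hGs i).fderiv_apply ℝ _)
  have hIW : ∀ i j, Integrable (pd j (W i j)) := fun i j =>
    ((hW1 i j).pd (k := 0) (by simp)).continuous.integrable_of_hasCompactSupport
      ((hWs i j).fderiv_apply ℝ _)
  have hIGs : Integrable fun z => t * ∑ i, pd i (G i) z :=
    (integrable_finsetSum _ fun i _ => hIG i).const_mul t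
  have hIWs : Integrable fun z => ∑ i, ∑ j, pd j (W i j) z :=
    integrable_finsetSum _ fun i _ => integrable_finsetSum _ fun j _ => hIW i j
  have hITG : Integrable fun z => t * (fderiv ℝ w (y + t • z) z * φ z) + t * ∑ i, pd i (G i) z :=
    (hIT.const_mul t).add hIGs
  have hint : ∫ z, (t * (fderiv ℝ w (y + t • z) z * φ z) + t * ∑ i, pd i (G i) z +
      ∑ i, ∑ j, pd j (W i j) z) = t * ∫ z, fderiv ℝ w (y + t • z) z * φ z := by
    rw [integral_add hITG hIWs, integral_add (hIT.const_mul t) hIGs,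
      integral_const_mul, integral_const_mul, integral_finsetSum _ fun i _ => hIG i,
      integral_finsetSum _ fun i _ => integrable_finsetSum _ fun j _ => hIW i j]
    have e1 : ∀ i, ∫ z, ∑ j, pd j (W i j) z = 0 := fun i => by
      rw [integral_finsetSum _ fun j _ => hIW i j]
      exact Finset.sum_eq_zero fun j _ => integral_pd_eq_zero (hW1 i j) (hWs i j)
    have e2 : ∀ i, ∫ z, pd i (G i) z = 0 := fun i => integral_pd_eq_zero (hG1 i) (hGs i)
    rw [Finset.sum_eq_zero fun i _ => e2 i, Finset.sum_eq_zero fun i _ => e1 i]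
    ring
  have hmono : ∫ z, (Metric.closedBall (0 : EuclideanSpace ℝ (Fin m)) R).indicator
      (fun _ => -(t * (C * N))) z ≤ ∫ z, (t * (fderiv ℝ w (y + t • z) z * φ z) +
        t * ∑ i, pd i (G i) z + ∑ i, ∑ j, pd j (W i j) z) :=
    integral_mono ((integrableOn_const measure_closedBall_lt_top.ne).integrable_indicator
      measurableSet_closedBall) (hITG.add hIWs)
      fun z => (hlow z).trans_eq (hkey z).symm
  rw [hint, integral_indicator measurableSet_closedBall, setIntegral_const, smul_eq_mul] at hmono
  refine le_of_mul_le_mul_left ?_ ht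
  linarith

lemma IsMeanValueKernel.mul_le_integral_add {a : EuclideanSpace ℝ (Fin m) → Fin m → Fin m → ℝ}
    {w ψ φ : EuclideanSpace ℝ (Fin m) → ℝ} {Φ : Fin m → EuclideanSpace ℝ (Fin m) → ℝ}
    {y : EuclideanSpace ℝ (Fin m)} {P : Matrix (Fin m) (Fin m) ℝ} {R H κ A Λ N s : ℝ}
    (hker : IsMeanValueKernel P R H κ ψ φ Φ)
    (ha : ∀ i j, ContDiff ℝ 1 fun x => a x i j) (hw : ContDiff ℝ 2 w)
    (hs : 0 < s) (hR : 0 ≤ R) (hH : 0 ≤ H) (hA : 0 ≤ A) (hΛ : 0 ≤ Λ)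
    (hpd : ∀ x ∈ Metric.closedBall y (s * R), ∀ i j k, |pd k (fun x => a x i j) x| ≤ A)
    (hP : ∀ x ∈ Metric.closedBall y (s * R), ∀ i j, |a x i j - P i j| ≤ A * dist x y)
    (hw0 : ∀ x ∈ Metric.closedBall y (s * R), 0 ≤ w x ∧ w x ≤ N)
    (hsub : ∀ x ∈ Metric.closedBall y (s * R),
      -Λ * w x ≤ ∑ i, pd i (fun y => ∑ j, a y i j * pd j w y) x) :
    κ * w y ≤ H * ((s ^ m)⁻¹ * ∫ x in Metric.closedBall y (s * R), w x) +
      (s * (Λ * H) + m ^ 2 * (A * H + A * R * H)) * N *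
      volume.real (Metric.closedBall (0 : EuclideanSpace ℝ (Fin m)) R) * s := by
  set vol := volume.real (Metric.closedBall (0 : EuclideanSpace ℝ (Fin m)) R) with hvol
  have hw1 : ContDiff ℝ 1 w := hw.of_le (by norm_num)
  have hy : y ∈ Metric.closedBall y (s * R) := Metric.mem_closedBall_self (by positivity)
  have hN : 0 ≤ N := (hw0 y hy).1.trans (hw0 y hy).2
  have hder := hasDerivAt_integral_comp_add_smul_mul hw1 hker.contDiff_weight.continuous
    hker.weight_eq_zero y
  have hmv := (convex_Icc (0 : ℝ) s).mul_sub_le_image_sub_of_le_deriv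
    (f := fun t : ℝ => ∫ z, w (y + t • z) * φ z)
    (C := -((s * (Λ * H) + m ^ 2 * (A * H + A * R * H)) * N * vol))
    (fun t _ => (hder t).continuousAt.continuousWithinAt)
    (fun t _ => (hder t).differentiableAt.differentiableWithinAt)
    (fun t ht => by
      rw [interior_Icc] at ht
      have hsubset : Metric.closedBall y (t * R) ⊆ Metric.closedBall y (s * R) :=
        Metric.closedBall_subset_closedBall (mul_le_mul_of_nonneg_right ht.2.le hR)
      rw [(hder t).deriv]
      refine le_trans ?_ (hker.le_mul_integral_fderiv_mul ha hw ht.1 hH hA hΛ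
        (fun x hx => hpd x (hsubset hx))
        (fun x hx i j => (hP x (hsubset hx) i j).trans
          (mul_le_mul_of_nonneg_left hx hA))
        (fun x hx => hw0 x (hsubset hx)) (fun x hx => hsub x (hsubset hx)))
      have := ht.2.le
      have h0 := ht.1.le
      refine neg_le_neg ?_
      have : 0 ≤ vol := measureReal_nonneg
      gcongr)
    0 ⟨le_rfl, hs.le⟩ s ⟨hs.le, le_rfl⟩ hs.le
  simp only [zero_smul, add_zero, sub_zero] at hmv
  rw [integral_const_mul] at hmv
  have h1 : κ * w y ≤ w y * ∫ z, φ z := by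
    rw [mul_comm]; exact mul_le_mul_of_nonneg_left hker.le_integral_weight (hw0 y hy).1
  have hwc := hw.continuous
  have hφc := hker.contDiff_weight.continuous
  have h2 : ∫ z, w (y + s • z) * φ z ≤
      H * ((s ^ m)⁻¹ * ∫ x in Metric.closedBall y (s * R), w x) := by
    have e1 : ∫ z, w (y + s • z) * φ z =
        ∫ z in Metric.closedBall (0 : EuclideanSpace ℝ (Fin m)) R, w (y + s • z) * φ z := by
      refine (setIntegral_eq_integral_of_forall_compl_eq_zero fun z hz => ?_).symm
      rw [hker.weight_eq_zero z (by simpa using hz), mul_zero]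
    have e2 : ∫ z in Metric.closedBall (0 : EuclideanSpace ℝ (Fin m)) R, w (y + s • z) * φ z ≤
        ∫ z in Metric.closedBall (0 : EuclideanSpace ℝ (Fin m)) R, H * w (y + s • z) := by
      refine setIntegral_mono_on
        (ContinuousOn.integrableOn_compact (isCompact_closedBall _ _) (by fun_prop))
        (ContinuousOn.integrableOn_compact (isCompact_closedBall _ _) (by fun_prop))
        measurableSet_closedBall fun z hz => ?_
      have hx : y + s • z ∈ Metric.closedBall y (s * R) := by
        rw [Metric.mem_closedBall, dist_eq_norm, add_sub_cancel_left, norm_smul,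
          Real.norm_of_nonneg hs.le]
        exact mul_le_mul_of_nonneg_left (by simpa using hz) hs.le
      rw [mul_comm]
      exact mul_le_mul_of_nonneg_right (hker.weight_le z) (hw0 _ hx).1
    rw [e1]
    refine e2.trans_eq ?_
    rw [integral_const_mul]
    congr 1
    rw [Measure.setIntegral_comp_smul_of_pos volume (fun x => w (y + x)) _ hs,
      smul_closedBall _ _ hR,
      smul_zero, Real.norm_of_nonneg hs.le, finrank_euclideanSpace_fin, smul_eq_mul]
    congr 1
    have := (measurePreserving_add_left volume y).setIntegral_preimage_emb
      (MeasurableEquiv.addLeft y).measurableEmbedding w (Metric.closedBall y (s * R))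
    rw [← this]
    congr 2
    ext x
    simp [dist_eq_norm]
  linarith

end MeanValue

section Subsolutions

variable {m : ℕ}

/-- Local boundedness of nonnegative subsolutions of `-div (a ∇w) ≤ Λ w`: the point maximizing
`(r - ‖x‖) ^ m * w x` is compared with the mean of `w` over a proportional ball. -/
lemma exists_subsolution_bound (m : ℕ) {r e A Λ : ℝ} (hr : 0 < r) (he : 0 < e) (hA : 0 ≤ A)
    (hΛ : 0 ≤ Λ) : ∃ C, 0 ≤ C ∧
      ∀ (a : EuclideanSpace ℝ (Fin m) → Fin m → Fin m → ℝ) (w : EuclideanSpace ℝ (Fin m) → ℝ),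
      (∀ i j, ContDiff ℝ 1 fun x => a x i j) → ContDiff ℝ 2 w →
      (∀ x ∈ Metric.ball (0 : EuclideanSpace ℝ (Fin m)) r, ∀ i j, a x i j = a x j i) →
      (∀ x ∈ Metric.ball (0 : EuclideanSpace ℝ (Fin m)) r, ∀ ξ : Fin m → ℝ,
        e * ∑ i, (ξ i) ^ 2 ≤ ∑ i, ∑ j, a x i j * ξ i * ξ j) →
      (∀ x ∈ Metric.ball (0 : EuclideanSpace ℝ (Fin m)) r, ∀ i j, |a x i j| ≤ A) →
      (∀ x ∈ Metric.ball (0 : EuclideanSpace ℝ (Fin m)) r, ∀ i j,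
        ‖fderiv ℝ (fun y => a y i j) x‖ ≤ A) →
      (∀ x, 0 ≤ w x) →
      (∀ x ∈ Metric.ball (0 : EuclideanSpace ℝ (Fin m)) r,
        -Λ * w x ≤ ∑ i, pd i (fun y => ∑ j, a y i j * pd j w y) x) →
      w 0 ≤ C * ∫ x in Metric.ball (0 : EuclideanSpace ℝ (Fin m)) r, w x := by
  obtain ⟨R, H, κ, hR, hH, hκ, hker⟩ := exists_isMeanValueKernel m (A := A) he
  set vol := volume.real (Metric.closedBall (0 : EuclideanSpace ℝ (Fin m)) R) with hvol
  have hvol0 : 0 ≤ vol := measureReal_nonneg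
  set D := (r * (Λ * H) + m ^ 2 * (A * H + A * R * H)) * 2 ^ m * vol with hD
  have hD0 : 0 ≤ D := by positivity
  set θ := min (1 / (2 * R)) (min 1 (κ / (2 * (D * r + 1)))) with hθ
  have hθ0 : 0 < θ := by positivity
  have hθR : θ * R ≤ 1 / 2 := by
    calc θ * R ≤ 1 / (2 * R) * R := mul_le_mul_of_nonneg_right (min_le_left _ _) hR.le
      _ = 1 / 2 := by field_simp
  have hθ1 : θ ≤ 1 := (min_le_right _ _).trans (min_le_left _ _)
  have hθκ : D * (θ * r) ≤ κ / 2 := by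
    have h1 : θ ≤ κ / (2 * (D * r + 1)) := (min_le_right _ _).trans (min_le_right _ _)
    rw [le_div_iff₀ (by positivity)] at h1
    linarith
  refine ⟨2 * H / κ * (θ ^ m)⁻¹ * (r ^ m)⁻¹, by positivity,
    fun a w ha hw hsym hell hab hda hw0 hsub => ?_⟩
  have hwc := hw.continuous
  set I := ∫ x in Metric.ball (0 : EuclideanSpace ℝ (Fin m)) r, w x
  have hI0 : 0 ≤ I := integral_nonneg fun x => hw0 x
  rcases (hw0 0).eq_or_lt with h0 | h0
  · rw [← h0]; positivity
  obtain ⟨y, hyr, hymax⟩ := (isCompact_closedBall (0 : EuclideanSpace ℝ (Fin m)) r).exists_isMaxOn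
    ⟨0, Metric.mem_closedBall_self hr.le⟩
    (f := fun x => (r - ‖x‖) ^ m * w x) (by fun_prop)
  have hymax0 : r ^ m * w 0 ≤ (r - ‖y‖) ^ m * w y := by
    simpa using hymax (Metric.mem_closedBall_self hr.le)
  set d := r - ‖y‖ with hd
  have hyr' : ‖y‖ ≤ r := by simpa using hyr
  have hd0 : 0 < d := by
    rcases (show 0 ≤ d by linarith).eq_or_lt with hd' | hd'
    · exfalso
      have hm : m ≠ 0 := by
        rintro rfl
        have : ‖y‖ = 0 := by rw [Subsingleton.elim y 0, norm_zero]
        linarith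
      rw [← hd', zero_pow hm, zero_mul] at hymax0
      exact absurd hymax0 (not_le.2 (by positivity))
    · exact hd'
  have hdr : d ≤ r := by linarith [norm_nonneg y]
  set s := θ * d with hs
  have hs0 : 0 < s := by positivity
  have hsr : s ≤ r := (mul_le_of_le_one_left hd0.le hθ1).trans hdr
  have hsR : s * R ≤ d / 2 := by
    calc s * R = θ * R * d := by rw [hs]; ring
      _ ≤ 1 / 2 * d := mul_le_mul_of_nonneg_right hθR hd0.le
      _ = d / 2 := by ring
  have hnorm : ∀ x ∈ Metric.closedBall y (s * R), d / 2 ≤ r - ‖x‖ := by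
    intro x hx
    have h1 : ‖x - y‖ ≤ d / 2 := by
      rw [← dist_eq_norm]; exact (Metric.mem_closedBall.1 hx).trans hsR
    have h2 : ‖x‖ ≤ ‖y‖ + ‖x - y‖ := by simpa using norm_add_le y (x - y)
    linarith
  have hball : Metric.closedBall y (s * R) ⊆ Metric.ball 0 r := fun x hx => by
    rw [mem_ball_zero_iff]
    linarith [hnorm x hx]
  have hyball : y ∈ Metric.ball (0 : EuclideanSpace ℝ (Fin m)) r :=
    hball (Metric.mem_closedBall_self (by positivity))
  have hwN : ∀ x ∈ Metric.closedBall y (s * R), 0 ≤ w x ∧ w x ≤ 2 ^ m * w y := by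
    refine fun x hx => ⟨hw0 x, ?_⟩
    have h1 : (d / 2) ^ m * w x ≤ d ^ m * w y :=
      (mul_le_mul_of_nonneg_right (pow_le_pow_left₀ (by positivity) (hnorm x hx) m) (hw0 x)).trans
        (hymax (Metric.ball_subset_closedBall (hball hx)))
    rw [div_pow, div_mul_eq_mul_div, div_le_iff₀ (by positivity), mul_assoc] at h1
    have := le_of_mul_le_mul_left h1 (by positivity)
    linarith
  have hpd : ∀ x ∈ Metric.closedBall y (s * R), ∀ i j k, |pd k (fun x => a x i j) x| ≤ A := by
    intro x hx i j k
    refine ((fderiv ℝ (fun x => a x i j) x).le_opNorm _).trans ?_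
    simpa using hda x (hball hx) i j
  have hlip : ∀ x ∈ Metric.closedBall y (s * R), ∀ i j, |a x i j - a y i j| ≤ A * dist x y := by
    intro x hx i j
    rw [dist_eq_norm]
    exact (convex_ball (0 : EuclideanSpace ℝ (Fin m)) r).norm_image_sub_le_of_norm_fderiv_le
      (fun x _ => (ha i j).differentiable one_ne_zero x) (fun x hx => hda x hx i j) hyball
      (hball hx)
  obtain ⟨ψ, φ, Φ, hk⟩ := hker (Matrix.of (a y)) (hsym y hyball) (hell y hyball) (hab y hyball)
  have hmain := hk.mul_le_integral_add ha hw hs0 hR.le hH.le hA hΛ hpd hlip hwN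
    fun x hx => hsub x (hball hx)
  have hIle : ∫ x in Metric.closedBall y (s * R), w x ≤ I :=
    setIntegral_mono_set
      ((hwc.continuousOn.integrableOn_compact (isCompact_closedBall _ _)).mono_set
        Metric.ball_subset_closedBall)
      (Filter.Eventually.of_forall fun x => hw0 x) hball.eventuallyLE
  have herr : (s * (Λ * H) + m ^ 2 * (A * H + A * R * H)) * (2 ^ m * w y) * vol * s ≤
      κ / 2 * w y := by
    have hwy := hw0 y
    calc (s * (Λ * H) + m ^ 2 * (A * H + A * R * H)) * (2 ^ m * w y) * vol * s
        ≤ (r * (Λ * H) + m ^ 2 * (A * H + A * R * H)) * (2 ^ m * w y) * vol * (θ * r) := by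
          have hsθ : s ≤ θ * r := by rw [hs]; gcongr
          gcongr
      _ = D * (θ * r) * w y := by rw [hD]; ring
      _ ≤ κ / 2 * w y := mul_le_mul_of_nonneg_right hθκ hwy
  have hfirst : H * ((s ^ m)⁻¹ * ∫ x in Metric.closedBall y (s * R), w x) ≤
      H * ((s ^ m)⁻¹ * I) :=
    mul_le_mul_of_nonneg_left (mul_le_mul_of_nonneg_left hIle (by positivity)) hH.le
  have h1 : κ / 2 * w y ≤ H * ((s ^ m)⁻¹ * I) := by linarith
  have h2 : r ^ m * w 0 ≤ 2 * H / κ * (θ ^ m)⁻¹ * I := by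
    refine hymax0.trans ?_
    have h3 := mul_le_mul_of_nonneg_left h1 (show 0 ≤ 2 / κ * d ^ m by positivity)
    have e1 : 2 / κ * d ^ m * (κ / 2 * w y) = d ^ m * w y := by field_simp
    have e2 : 2 / κ * d ^ m * (H * ((s ^ m)⁻¹ * I)) = 2 * H / κ * (θ ^ m)⁻¹ * I := by
      rw [hs, mul_pow]; field_simp
    linarith
  have h4 := mul_le_mul_of_nonneg_left h2 (show 0 ≤ (r ^ m)⁻¹ by positivity)
  rw [← mul_assoc, inv_mul_cancel₀ (by positivity), one_mul] at h4
  linarith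

lemma div_sqrt_mul_le_sum_pd {a : EuclideanSpace ℝ (Fin m) → Fin m → Fin m → ℝ}
    {f w : EuclideanSpace ℝ (Fin m) → ℝ} {ε : ℝ} {x : EuclideanSpace ℝ (Fin m)}
    (ha : ∀ i j, ContDiff ℝ 1 fun x => a x i j) (hf : ContDiff ℝ 2 f) (hw : ContDiff ℝ 2 w)
    (hw0 : ∀ x, 0 < w x) (hwf : ∀ x, w x * w x = f x * f x + ε ^ 2)
    (hell : 0 ≤ ∑ i, ∑ j, a x i j * pd i f x * pd j f x) :
    f x / w x * ∑ i, pd i (fun y => ∑ j, a y i j * pd j f y) x ≤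
      ∑ i, pd i (fun y => ∑ j, a y i j * pd j w y) x := by
  have hdf : Differentiable ℝ f := hf.differentiable two_ne_zero
  have hdw : Differentiable ℝ w := hw.differentiable two_ne_zero
  set k : EuclideanSpace ℝ (Fin m) → ℝ := fun x => f x / w x with hk
  have hdk : Differentiable ℝ k :=
    (hf.div hw fun x => (hw0 x).ne').differentiable two_ne_zero
  have hpw : ∀ i x, pd i w x = k x * pd i f x := by
    intro i x
    have h1 := pd_mul (i := i) (hdw x) (hdw x)
    have h2 : pd i (fun y => w y * w y) x = 2 * f x * pd i f x := by
      have : (fun y => w y * w y) = fun y => f y * f y + ε ^ 2 := funext hwf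
      rw [this]
      have h3 := pd_mul (i := i) (hdf x) (hdf x)
      simp only [pd] at h3 ⊢
      rw [fderiv_add_const, h3]
      ring
    have := hw0 x
    rw [hk]
    field_simp
    linarith
  have hpk : ∀ i, pd i k x = ε ^ 2 / w x ^ 3 * pd i f x := by
    intro i
    have h1 := pd_mul (i := i) (hdk x) (hdw x)
    have h2 : (fun y => k y * w y) = f := funext fun y => div_mul_cancel₀ _ (hw0 y).ne'
    rw [h2, hpw] at h1
    have hwx := hw0 x
    have h3 : pd i k x * w x = pd i f x * (1 - k x * k x) := by linarith
    have h4 : 1 - k x * k x = ε ^ 2 / w x ^ 2 := by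
      rw [hk]
      field_simp
      linarith [hwf x]
    rw [h4] at h3
    rw [← mul_left_inj' hwx.ne', h3]
    field_simp
  have hg : ∀ i, ContDiff ℝ 1 fun y => ∑ j, a y i j * pd j f y := fun i =>
    ContDiff.sum fun j _ => (ha i j).mul (hf.pd (by norm_num))
  have hsum : ∀ i, pd i (fun y => ∑ j, a y i j * pd j w y) x =
      ε ^ 2 / w x ^ 3 * (∑ j, a x i j * pd i f x * pd j f x) +
        k x * pd i (fun y => ∑ j, a y i j * pd j f y) x := by
    intro i
    have h1 : (fun y => ∑ j, a y i j * pd j w y) = fun y => k y * ∑ j, a y i j * pd j f y := by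
      funext y
      rw [Finset.mul_sum]
      exact Finset.sum_congr rfl fun j _ => by rw [hpw]; ring
    rw [h1, pd_mul (hdk x) ((hg i).differentiable one_ne_zero x), hpk, Finset.mul_sum,
      Finset.mul_sum]
    congr 1
    exact Finset.sum_congr rfl fun j _ => by ring
  simp only [hsum, Finset.sum_add_distrib, ← Finset.mul_sum]
  have := hw0 x
  have : 0 ≤ ε ^ 2 / w x ^ 3 * ∑ i, ∑ j, a x i j * pd i f x * pd j f x := by positivity
  linarith

lemma exists_contDiff_eqOn_closedBall {E : Type*} [NormedAddCommGroup E] [InnerProductSpace ℝ E]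
    [ProperSpace E] {f : E → ℝ} {U : Set E} {r : ℝ} {n : ℕ} (hr : 0 < r) (hU : IsOpen U)
    (hrU : Metric.closedBall 0 r ⊆ U) (hf : ContDiffOn ℝ n f U) :
    ∃ g : E → ℝ, ContDiff ℝ n g ∧ EqOn g f (Metric.closedBall 0 r) := by
  obtain ⟨η, hη, hηU⟩ := (isCompact_closedBall (0 : E) r).exists_cthickening_subset_open hU hrU
  rw [cthickening_closedBall hη.le hr.le] at hηU
  let χ : ContDiffBump (0 : E) := ⟨r, η + r, hr, by linarith⟩
  refine ⟨fun x => χ x * f x, ?_, fun x hx => ?_⟩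
  · rw [contDiff_iff_contDiffAt]
    intro x
    by_cases hx : x ∈ U
    · exact χ.contDiffAt.mul (hf.contDiffAt (hU.mem_nhds hx))
    · have hx' : x ∉ tsupport χ := by
        rw [χ.tsupport_eq]
        exact fun h => hx (hηU (by simpa [χ, add_comm] using h))
      have : (fun y => χ y * f y) =ᶠ[nhds x] fun _ => 0 := by
        filter_upwards [notMem_tsupport_iff_eventuallyEq.1 hx'] with y hy
        simp [hy]
      exact contDiffAt_const.congr_of_eventuallyEq this
  · simp [χ.one_of_mem_closedBall hx]

end Subsolutions

/-- Key regularity lemma in flat coordinates: a pointwise bound at the centre of a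
coordinate ball in terms of the local `W¹`-norm plus `ε`, for solutions of
`(D - λ)f = δ` in divergence form with small potential and small inhomogeneity,
under a Dirichlet Rayleigh-quotient lower bound `3K`. -/
theorem flat_regularity_lemma (m : ℕ) (r e A K : ℝ)
    (hr : 0 < r) (he : 0 < e) (hA : 0 < A) (hK : 0 < K) :
    ∃ C : ℝ, ∀ (ε lam : ℝ), ε ∈ Set.Ioo (0 : ℝ) 1 → lam ∈ Set.Icc (0 : ℝ) K →
      ∀ (a : EuclideanSpace ℝ (Fin m) → Fin m → Fin m → ℝ)
        (c δ f : EuclideanSpace ℝ (Fin m) → ℝ),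
      ContDiff ℝ (⊤ : ℕ∞) a → ContDiff ℝ (⊤ : ℕ∞) c → ContDiff ℝ (⊤ : ℕ∞) δ →
      (∀ x ∈ closure (Metric.ball (0 : EuclideanSpace ℝ (Fin m)) r),
        ∀ i j, a x i j = a x j i) →
      (∀ x ∈ closure (Metric.ball (0 : EuclideanSpace ℝ (Fin m)) r), ∀ ξ : Fin m → ℝ,
        e * ∑ i, (ξ i) ^ 2 ≤ ∑ i, ∑ j, a x i j * ξ i * ξ j) →
      (∀ i j, ∀ n ≤ m + 2, ∀ x ∈ closure (Metric.ball (0 : EuclideanSpace ℝ (Fin m)) r),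
        ‖iteratedFDeriv ℝ n (fun y => a y i j) x‖ ≤ A) →
      (∀ n ≤ m + 2, ∀ x ∈ closure (Metric.ball (0 : EuclideanSpace ℝ (Fin m)) r),
        ‖iteratedFDeriv ℝ n c x‖ ≤ A) →
      (∃ M₁ M₂ : ℝ,
        (∀ x ∈ closure (Metric.ball (0 : EuclideanSpace ℝ (Fin m)) r), |δ x| ≤ M₁) ∧
        (∀ x ∈ closure (Metric.ball (0 : EuclideanSpace ℝ (Fin m)) r), |c x| ≤ M₂) ∧
        M₁ + M₂ ≤ K * ε) →
      (∀ φ : EuclideanSpace ℝ (Fin m) → ℝ, ContDiff ℝ (⊤ : ℕ∞) φ → HasCompactSupport φ →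
        tsupport φ ⊆ Metric.ball (0 : EuclideanSpace ℝ (Fin m)) r →
        3 * K * ∫ x in Metric.ball (0 : EuclideanSpace ℝ (Fin m)) r, (φ x) ^ 2 ≤
          ∫ x in Metric.ball (0 : EuclideanSpace ℝ (Fin m)) r,
            ((∑ i, ∑ j, a x i j * pd i φ x * pd j φ x) + c x * (φ x) ^ 2)) →
      (∃ U : Set (EuclideanSpace ℝ (Fin m)), IsOpen U ∧
        closure (Metric.ball (0 : EuclideanSpace ℝ (Fin m)) r) ⊆ U ∧ ContDiffOn ℝ 2 f U) →
      (∀ x ∈ Metric.ball (0 : EuclideanSpace ℝ (Fin m)) r,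
        -(∑ i, pd i (fun y => ∑ j, a y i j * pd j f y) x) + c x * f x - lam * f x = δ x) →
      |f 0| ≤ C * (Real.sqrt (∫ x in Metric.ball (0 : EuclideanSpace ℝ (Fin m)) r,
          ((f x) ^ 2 + ∑ i, (pd i f x) ^ 2)) + ε) := by
  obtain ⟨C, hC, hbound⟩ := exists_subsolution_bound m (Λ := 3 * K) hr he hA.le (by positivity)
  set vol := volume.real (Metric.ball (0 : EuclideanSpace ℝ (Fin m)) r) with hvol
  have hvol0 : 0 ≤ vol := measureReal_nonneg
  refine ⟨C * (1 + 2 * vol), ?_⟩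
  intro ε lam hε hlam a c δ f ha _ _ hsym hell hab _ hδc _ hfU heq
  rw [closure_ball (0 : EuclideanSpace ℝ (Fin m)) hr.ne'] at hsym hell hab hδc hfU
  obtain ⟨M₁, M₂, hδ, hc, hM⟩ := hδc
  obtain ⟨U, hU, hrU, hfU⟩ := hfU
  obtain ⟨f', hf', hff'⟩ := exists_contDiff_eqOn_closedBall (n := 2) hr hU hrU hfU
  have hf' : ContDiff ℝ 2 f' := hf'
  have hsub : Metric.ball (0 : EuclideanSpace ℝ (Fin m)) r ⊆ Metric.closedBall 0 r :=
    Metric.ball_subset_closedBall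
  have hnhds : ∀ x ∈ Metric.ball (0 : EuclideanSpace ℝ (Fin m)) r, f =ᶠ[nhds x] f' := fun x hx =>
    Filter.eventuallyEq_of_mem (Metric.isOpen_ball.mem_nhds hx) fun y hy => (hff' (hsub hy)).symm
  have hpd : ∀ x ∈ Metric.ball (0 : EuclideanSpace ℝ (Fin m)) r, ∀ i, pd i f x = pd i f' x :=
    fun x hx i => by rw [pd, pd, (hnhds x hx).fderiv_eq]
  have hpd2 : ∀ x ∈ Metric.ball (0 : EuclideanSpace ℝ (Fin m)) r, ∀ i,
      pd i (fun y => ∑ j, a y i j * pd j f y) x = pd i (fun y => ∑ j, a y i j * pd j f' y) x := by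
    intro x hx i
    have : (fun y => ∑ j, a y i j * pd j f y) =ᶠ[nhds x] fun y => ∑ j, a y i j * pd j f' y := by
      filter_upwards [Metric.isOpen_ball.mem_nhds hx] with y hy
      exact Finset.sum_congr rfl fun j _ => by rw [hpd y hy]
    rw [pd, pd, this.fderiv_eq]
  have h0mem : (0 : EuclideanSpace ℝ (Fin m)) ∈ Metric.ball 0 r := Metric.mem_ball_self hr
  have hM₁ : 0 ≤ M₁ := (abs_nonneg _).trans (hδ 0 (hsub h0mem))
  have hM₂ : 0 ≤ M₂ := (abs_nonneg _).trans (hc 0 (hsub h0mem))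
  have hε0 := hε.1
  have ha1 : ∀ i j, ContDiff ℝ 1 fun x => a x i j := fun i j => by
    have : ContDiff ℝ 1 a := ha.of_le (by exact_mod_cast le_top)
    exact contDiff_pi.1 (contDiff_pi.1 this i) j
  set w : EuclideanSpace ℝ (Fin m) → ℝ := fun x => Real.sqrt (f' x * f' x + ε ^ 2) with hw
  have hpos : ∀ x, 0 < f' x * f' x + ε ^ 2 := fun x => by
    have := mul_self_nonneg (f' x); positivity
  have hwsm : ContDiff ℝ 2 w :=
    ((hf'.mul hf').add contDiff_const).sqrt fun x => (hpos x).ne'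
  have hw0 : ∀ x, 0 < w x := fun x => Real.sqrt_pos.2 (hpos x)
  have hwf : ∀ x, w x * w x = f' x * f' x + ε ^ 2 := fun x => Real.mul_self_sqrt (hpos x).le
  have hfw : ∀ x, |f' x| ≤ w x := fun x => Real.abs_le_sqrt (by nlinarith)
  have hεw : ∀ x, ε ≤ w x := fun x => Real.le_sqrt_of_sq_le (by nlinarith [mul_self_nonneg (f' x)])
  have hwle : ∀ x, w x ≤ |f' x| + ε := fun x => by
    rw [hw]
    refine Real.sqrt_le_iff.2 ⟨by positivity, ?_⟩
    nlinarith [abs_mul_abs_self (f' x), abs_nonneg (f' x)]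
  have hsubsol : ∀ x ∈ Metric.ball (0 : EuclideanSpace ℝ (Fin m)) r,
      -(3 * K) * w x ≤ ∑ i, pd i (fun y => ∑ j, a y i j * pd j w y) x := by
    intro x hx
    refine le_trans ?_ (div_sqrt_mul_le_sum_pd ha1 hf' hwsm hw0 hwf
      (le_trans (by positivity) (hell x (hsub hx) fun i => pd i f' x)))
    have hx1 := heq x hx
    simp only [hpd2 x hx, ← hff' (hsub hx)] at hx1
    have hx2 : ∑ i, pd i (fun y => ∑ j, a y i j * pd j f' y) x =
        (c x - lam) * f' x - δ x := by linarith
    rw [hx2]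
    have e1 : |f' x / w x| ≤ 1 := by
      rw [abs_div, abs_of_pos (hw0 x)]
      exact div_le_one_of_le₀ (hfw x) (hw0 x).le
    have e2 : |c x - lam| ≤ 2 * K - M₁ := by
      have := hc x (hsub hx)
      have h1 : |c x - lam| ≤ |c x| + |lam| := abs_sub _ _
      rw [abs_of_nonneg hlam.1] at h1
      have : K * ε ≤ K := mul_le_of_le_one_right hK.le hε.2.le
      linarith [hlam.2]
    have e3 : |(c x - lam) * f' x - δ x| ≤ 3 * K * w x := by
      refine (abs_sub _ _).trans ?_
      rw [abs_mul]
      have h1 : |c x - lam| * |f' x| ≤ 2 * K * w x :=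
        mul_le_mul (e2.trans (by linarith)) (hfw x) (abs_nonneg _) (by positivity)
      have h2 : |δ x| ≤ K * w x := (hδ x (hsub hx)).trans
        ((show M₁ ≤ K * ε by linarith).trans (mul_le_mul_of_nonneg_left (hεw x) hK.le))
      linarith
    have e4 : |f' x / w x * ((c x - lam) * f' x - δ x)| ≤ 3 * K * w x := by
      rw [abs_mul]
      exact (mul_le_of_le_one_left (abs_nonneg _) e1).trans e3
    linarith [neg_abs_le (f' x / w x * ((c x - lam) * f' x - δ x))]
  have hmain := hbound a w ha1 hwsm (fun x hx => hsym x (hsub hx)) (fun x hx => hell x (hsub hx))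
    (fun x hx i j => by
      have := hab i j 0 (by omega) x (hsub hx)
      rwa [norm_iteratedFDeriv_zero] at this)
    (fun x hx i j => by
      have := hab i j 1 (by omega) x (hsub hx)
      rwa [norm_iteratedFDeriv_one] at this)
    (fun x => (hw0 x).le) hsubsol
  have hint : ∫ x in Metric.ball (0 : EuclideanSpace ℝ (Fin m)) r,
      ((f x) ^ 2 + ∑ i, (pd i f x) ^ 2) =
      ∫ x in Metric.ball (0 : EuclideanSpace ℝ (Fin m)) r,
        ((f' x) ^ 2 + ∑ i, (pd i f' x) ^ 2) :=
    setIntegral_congr_fun measurableSet_ball fun x hx => by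
      simp only [hpd x hx, hff' (hsub hx)]
  rw [hint, ← hff' (hsub h0mem)]
  set J := ∫ x in Metric.ball (0 : EuclideanSpace ℝ (Fin m)) r,
    ((f' x) ^ 2 + ∑ i, (pd i f' x) ^ 2)
  have hJ0 : 0 ≤ J := integral_nonneg fun x => by positivity
  set S := Real.sqrt J + ε
  have hS0 : 0 < S := by positivity
  have hJS : J ≤ S ^ 2 := by
    nlinarith [Real.sq_sqrt hJ0, Real.sqrt_nonneg J]
  have hcont : ∀ g : EuclideanSpace ℝ (Fin m) → ℝ, Continuous g →
      IntegrableOn g (Metric.ball 0 r) := fun g hg =>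
    (hg.continuousOn.integrableOn_compact (isCompact_closedBall 0 r)).mono_set hsub
  have hfc := hf'.continuous
  have hpc : ∀ i, Continuous (pd i f') := fun i =>
    (hf'.pd (k := 0) (by norm_num)).continuous
  have hwint : ∫ x in Metric.ball (0 : EuclideanSpace ℝ (Fin m)) r, w x ≤ (1 + 2 * vol) * S := by
    calc ∫ x in Metric.ball (0 : EuclideanSpace ℝ (Fin m)) r, w x
        ≤ ∫ x in Metric.ball (0 : EuclideanSpace ℝ (Fin m)) r,
            (((f' x) ^ 2 + ∑ i, (pd i f' x) ^ 2) * S⁻¹ + 2 * S) := by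
          refine setIntegral_mono_on (hcont _ hwsm.continuous) (hcont _ (by fun_prop))
            measurableSet_ball fun x _ => ?_
          have h1 : |f' x| ≤ f' x ^ 2 * S⁻¹ + S := by
            rw [← sq_abs, ← div_eq_mul_inv, div_add' _ _ _ hS0.ne', le_div_iff₀ hS0]
            nlinarith [sq_nonneg (|f' x| - S), abs_nonneg (f' x), hS0]
          have h2 : f' x ^ 2 * S⁻¹ ≤ ((f' x) ^ 2 + ∑ i, (pd i f' x) ^ 2) * S⁻¹ := by
            refine mul_le_mul_of_nonneg_right ?_ (by positivity)
            exact le_add_of_nonneg_right (Finset.sum_nonneg fun i _ => sq_nonneg _)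
          have h3 : ε ≤ S := le_add_of_nonneg_left (Real.sqrt_nonneg J)
          linarith [hwle x]
      _ = J * S⁻¹ + 2 * S * vol := by
          rw [integral_add (hcont _ (by fun_prop)) (hcont _ (by fun_prop)),
            integral_mul_const, setIntegral_const, smul_eq_mul, mul_comm vol]
      _ ≤ (1 + 2 * vol) * S := by
          have : J * S⁻¹ ≤ S := by
            rw [← div_eq_mul_inv, div_le_iff₀ hS0]; linarith
          linarith
  calc |f' 0| ≤ w 0 := hfw 0
    _ ≤ C * ∫ x in Metric.ball (0 : EuclideanSpace ℝ (Fin m)) r, w x := hmain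
    _ ≤ C * ((1 + 2 * vol) * S) := mul_le_mul_of_nonneg_left hwint hC
    _ = C * (1 + 2 * vol) * S := by ring
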